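/- arXiv:2306.14577 — 5 statements merged into one kernel-verified Lean document; each statement's English description precedes it below -/
import Mathlib

section
/- Let X be a real normed vector space, let C ⊆ X be a convex set, and let G : X → ℝ be concave on C and Fréchet differentiable at every point of C. Suppose there exist m ∈ ℝ with G(f) ≥ m for all f ∈ C, a constant c₁ > 0, and a sequence (f_k)_{k∈ℕ} in C such that for every k, c₁ ‖f_{k+1} − f_k‖² ≤ −DG(f_k)(f_{k+1} − f_k), where DG(f_k) denotes the Fréchet derivative of G at f_k. Then the series Σ_{k=0}^∞ ‖f_{k+1} − f_k‖² converges, and Σ_{k=0}^∞ ‖f_{k+1} − f_k‖² ≤ (G(f₀) − m)/c₁. -/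
/-- Let `G : X → ℝ` be concave and Fréchet differentiable on a convex set
`C` of a real normed space, bounded below by `m` on `C`. If `c₁ > 0` and `(f_k) ⊆ C`
satisfies `c₁ ‖f_{k+1} − f_k‖² ≤ −DG(f_k)(f_{k+1} − f_k)` for all `k`, then
`Σ_k ‖f_{k+1} − f_k‖²` converges and is at most `(G(f₀) − m)/c₁`. -/
theorem summable_sq_increments_of_concave_descent
    {X : Type*} [NormedAddCommGroup X] [NormedSpace ℝ X]
    (C : Set X) (hC : Convex ℝ C) (G : X → ℝ) (DG : X → X →L[ℝ] ℝ)
    (hdiff : ∀ x ∈ C, HasFDerivAt G (DG x) x)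
    (hconc : ∀ x ∈ C, ∀ y ∈ C, ∀ t ∈ Set.Icc (0 : ℝ) 1,
      t * G x + (1 - t) * G y ≤ G (t • x + (1 - t) • y))
    (m : ℝ) (hm : ∀ f ∈ C, m ≤ G f)
    (c₁ : ℝ) (hc₁ : 0 < c₁)
    (f : ℕ → X) (hf : ∀ k, f k ∈ C)
    (hineq : ∀ k, c₁ * ‖f (k + 1) - f k‖ ^ 2 ≤ -(DG (f k)) (f (k + 1) - f k)) :
    Summable (fun k => ‖f (k + 1) - f k‖ ^ 2) ∧
      ∑' k, ‖f (k + 1) - f k‖ ^ 2 ≤ (G (f 0) - m) / c₁ := by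
  have key : ∀ x ∈ C, ∀ y ∈ C, G y - G x ≤ DG x (y - x) := by
    intro x hx y hy
    have h : HasDerivAt (fun t : ℝ => G (x + t • (y - x))) (DG x (y - x)) 0 :=
      (hdiff x hx).hasLineDerivAt (y - x)
    have h2 := h.tendsto_slope_zero_right
    refine ge_of_tendsto h2 ?_
    filter_upwards [Ioo_mem_nhdsGT (zero_lt_one (α := ℝ))] with t ht
    have h3 := hconc y hy x hx t ⟨ht.1.le, ht.2.le⟩
    have e : t • y + (1 - t) • x = x + t • (y - x) := by
      module
    rw [e] at h3
    simp only [zero_add, zero_smul, add_zero, smul_eq_mul]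
    rw [inv_mul_eq_div, le_div_iff₀ ht.1]
    linarith
  have hs : ∀ n, ∑ k ∈ Finset.range n, ‖f (k + 1) - f k‖ ^ 2 ≤ (G (f 0) - m) / c₁ := by
    intro n
    have h1 : c₁ * ∑ k ∈ Finset.range n, ‖f (k + 1) - f k‖ ^ 2 ≤ G (f 0) - G (f n) := by
      induction n with
      | zero => simp
      | succ n ih =>
        rw [Finset.sum_range_succ, mul_add]
        have := hineq n
        have := key (f n) (hf n) (f (n + 1)) (hf (n + 1))
        linarith
    rw [le_div_iff₀ hc₁]
    have := hm (f n) (hf n)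
    linarith
  exact ⟨summable_of_sum_range_le (fun _ => by positivity) hs,
    Real.tsum_le_of_sum_range_le (fun _ => by positivity) hs⟩
end

section
/- Let (Ω, μ) be a finite measure space and let E ⊆ Ω be measurable. Let (f_n)_{n∈ℕ} be measurable functions with 0 ≤ f_n ≤ 1 μ-a.e., and suppose ∫_Ω f_n g dμ → ∫_Ω 1_E g dμ as n → ∞ for every bounded measurable g : Ω → ℝ. Then f_n → 1_E strongly in L¹(μ), i.e. ‖f_n − 1_E‖_{L¹(μ)} → 0. In other words, on the set of [0,1]-valued functions, weak-* convergence to a characteristic function implies strong L¹ convergence. -/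
open MeasureTheory Filter Topology

/-- On a finite measure space, if `(f_n)` take values in `[0,1]` a.e. and
`f_n → 1_E` weakly-* (tested against bounded measurable functions), then `f_n → 1_E`
strongly in `L¹(μ)`: weak-* convergence to a characteristic function implies strong `L¹`
convergence. -/
theorem tendsto_L1_of_weakStar_to_indicator
    {Ω : Type*} [MeasurableSpace Ω] (μ : Measure Ω) [IsFiniteMeasure μ]
    (E : Set Ω) (hE : MeasurableSet E)
    (f : ℕ → Ω → ℝ) (hfm : ∀ n, Measurable (f n))
    (hf01 : ∀ n, ∀ᵐ x ∂μ, 0 ≤ f n x ∧ f n x ≤ 1)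
    (hconv : ∀ g : Ω → ℝ, Measurable g → (∃ M, ∀ x, |g x| ≤ M) →
      Tendsto (fun n => ∫ x, f n x * g x ∂μ) atTop
        (𝓝 (∫ x, E.indicator (fun _ => (1 : ℝ)) x * g x ∂μ))) :
    Tendsto (fun n => ∫ x, |f n x - E.indicator (fun _ => (1 : ℝ)) x| ∂μ) atTop (𝓝 0) := by
  set χ : Ω → ℝ := E.indicator (fun _ => (1 : ℝ)) with hχ
  have hχm : Measurable χ := measurable_const.indicator hE
  have hχ01 : ∀ x, χ x = 0 ∨ χ x = 1 := by
    intro x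
    by_cases hx : x ∈ E <;> simp [hχ, hx]
  have hgb : ∀ x, |1 - 2 * χ x| ≤ 1 := by
    intro x
    rcases hχ01 x with h | h <;> rw [h] <;> norm_num
  have hgm : Measurable (fun x => 1 - 2 * χ x) := by fun_prop
  have hχi : Integrable χ μ := (integrable_const (1 : ℝ)).indicator hE
  have key := (hconv (fun x => 1 - 2 * χ x) hgm ⟨1, hgb⟩).add_const (∫ x, χ x ∂μ)
  have hlim : (∫ x, χ x * (1 - 2 * χ x) ∂μ) + ∫ x, χ x ∂μ = 0 := by
    have h : (fun x => χ x * (1 - 2 * χ x)) = fun x => - χ x := by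
      funext x
      rcases hχ01 x with h | h <;> rw [h] <;> norm_num
    rw [h, integral_neg]
    ring
  rw [hlim] at key
  refine key.congr fun n => ?_
  have hint : Integrable (fun x => f n x * (1 - 2 * χ x)) μ := by
    refine Integrable.of_bound ((hfm n).mul hgm).aestronglyMeasurable 1 ?_
    filter_upwards [hf01 n] with x hx
    rw [Real.norm_eq_abs, abs_mul, abs_of_nonneg hx.1]
    exact mul_le_one₀ hx.2 (abs_nonneg _) (hgb x)
  rw [← integral_add hint hχi]
  refine integral_congr_ae ?_
  filter_upwards [hf01 n] with x hx
  rcases hχ01 x with h | h <;> simp only [h]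
  · rw [sub_zero, abs_of_nonneg hx.1]; ring
  · rw [abs_of_nonpos (by linarith [hx.2])]; ring
end

section
/- Let (X, d) be a metric space and let (x_k)_{k∈ℕ} be a sequence in X whose range is contained in a compact subset of X and which satisfies d(x_{k+1}, x_k) → 0 as k → ∞. Then either (x_k) converges in X, or the set of cluster points of (x_k) is infinite. -/
open Filter Topology

/-- In a metric space, a sequence whose range lies in a compact set and
whose consecutive increments tend to `0` either converges, or has infinitely many cluster
points (where a cluster point is a limit of some subsequence). -/
theorem converges_or_infinitely_many_cluster_points
    {X : Type*} [MetricSpace X] (x : ℕ → X)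
    (K : Set X) (hK : IsCompact K) (hxK : ∀ k, x k ∈ K)
    (hd : Tendsto (fun k => dist (x (k + 1)) (x k)) atTop (𝓝 0)) :
    (∃ l, Tendsto x atTop (𝓝 l)) ∨
      {l : X | ∃ φ : ℕ → ℕ, StrictMono φ ∧ Tendsto (fun j => x (φ j)) atTop (𝓝 l)}.Infinite := by
  by_cases hS : {l : X | ∃ φ : ℕ → ℕ, StrictMono φ ∧
      Tendsto (fun j => x (φ j)) atTop (𝓝 l)}.Infinite
  · exact Or.inr hS
  left
  rw [Set.not_infinite] at hS
  obtain ⟨a, -, φ, hφ, hφa⟩ := hK.tendsto_subseq hxK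
  refine ⟨a, ?_⟩
  have hcl := (hS.subset (Set.sdiff_subset (t := {a}))).isClosed
  have hnhds := hcl.isOpen_compl.mem_nhds (x := a) (by simp)
  obtain ⟨r, hr, hball⟩ := Metric.mem_nhds_iff.1 hnhds
  rw [Metric.tendsto_atTop]
  intro ε₀ hε₀
  obtain ⟨ε, hε, hεm⟩ : ∃ ε, 0 < ε ∧ ε < min r ε₀ := exists_between (lt_min hr hε₀)
  have hεr : ε < r := hεm.trans_le (min_le_left _ _)
  have hεε₀ : ε < ε₀ := hεm.trans_le (min_le_right _ _)
  have hA : IsCompact (K ∩ {y | ε / 2 ≤ dist y a ∧ dist y a ≤ ε}) := by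
    apply hK.inter_right
    have hc : Continuous (fun y : X => dist y a) := by fun_prop
    exact (isClosed_le continuous_const hc).inter (isClosed_le hc continuous_const)
  have hev : ∀ᶠ k in atTop, ¬ (x k ∈ K ∩ {y | ε / 2 ≤ dist y a ∧ dist y a ≤ ε}) := by
    by_contra hcon
    have hfr : ∃ᶠ k in atTop, x k ∈ K ∩ {y | ε / 2 ≤ dist y a ∧ dist y a ≤ ε} := hcon
    obtain ⟨b, hb, ψ, hψ, hψb⟩ := hA.tendsto_subseq' hfr
    obtain ⟨-, hb1, hb2⟩ := hb
    have hbr : b ∈ Metric.ball a r := lt_of_le_of_lt hb2 hεr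
    refine hball hbr ⟨⟨ψ, hψ, hψb⟩, ?_⟩
    intro hba
    rw [Set.mem_singleton_iff] at hba
    rw [hba, dist_self] at hb1
    linarith
  have hstep : ∀ᶠ k in atTop, dist (x (k + 1)) (x k) < ε / 2 :=
    hd.eventually_lt_const (by linarith)
  obtain ⟨N, hN⟩ := eventually_atTop.1 (hev.and hstep)
  obtain ⟨M, hM⟩ := Metric.tendsto_atTop.1 hφa (ε / 2) (by linarith)
  have h0 := hM (max M N) (le_max_left _ _)
  have hle : N ≤ φ (max M N) := (le_max_right _ _).trans hφ.le_apply
  refine ⟨φ (max M N), fun n hn => ?_⟩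
  have key : dist (x n) a < ε / 2 := by
    induction n, hn using Nat.le_induction with
    | base => exact h0
    | succ n hn ih =>
      have h1 := (hN n (hle.trans hn)).2
      have h2 := (hN (n + 1) (hle.trans (hn.trans n.le_succ))).1
      by_contra h3
      exact h2 ⟨hxK _, not_lt.1 h3, by linarith [dist_triangle (x (n + 1)) (x n) a]⟩
  linarith
end

section
/- Let (Ω, μ) be a finite measure space, V₀ ∈ (0,1), and let (f_k)_{k∈ℕ} be a sequence in the admissible class F(V₀) with ‖f_{k+1} − f_k‖_{L¹(μ)} → 0. Assume: (i) every subsequence of (f_k) admits a further subsequence (f_{k_j}) and a measurable set E ⊆ Ω with μ(E) = V₀ μ(Ω) such that ∫_Ω f_{k_j} g dμ → ∫_Ω 1_E g dμ for all bounded measurable g (i.e. every weak-* closure point is a bang-bang function of F(V₀)); and (ii) the sequence (f_k) has two distinct L¹-closure points. Then (f_k) has infinitely many L¹-closure points. -/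
open MeasureTheory Filter Topology

theorem aux_norm {Ω : Type*} [MeasurableSpace Ω] (μ : Measure Ω) [IsFiniteMeasure μ]
    (f : Lp ℝ 1 μ) (h : ∀ᵐ x ∂μ, 0 ≤ f x ∧ f x ≤ 1) (E : Set Ω) (hE : MeasurableSet E) :
    ‖f - indicatorConstLp 1 hE (measure_ne_top μ E) (1 : ℝ)‖
      = (∫ x, f x * (1 - 2 * E.indicator (fun _ => (1 : ℝ)) x) ∂μ)
        + ∫ x, E.indicator (fun _ => (1 : ℝ)) x ∂μ := by
  have hi : Integrable (E.indicator (fun _ => (1 : ℝ))) μ :=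
    (integrable_const (1 : ℝ)).indicator hE
  have hf : Integrable f μ := L1.integrable_coeFn f
  have hfi : Integrable (fun x => f x * (1 - 2 * E.indicator (fun _ => (1 : ℝ)) x)) μ := by
    have : (fun x => f x * (1 - 2 * E.indicator (fun _ => (1 : ℝ)) x))
        = fun x => f x - 2 * E.indicator f x := by
      ext x
      by_cases hx : x ∈ E <;> simp [hx]; ring
    rw [this]
    exact hf.sub ((hf.indicator hE).const_mul 2)
  rw [L1.norm_eq_integral_norm, ← integral_add hfi hi]
  apply integral_congr_ae
  filter_upwards [h, Lp.coeFn_sub f (indicatorConstLp 1 hE (measure_ne_top μ E) (1 : ℝ)),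
    indicatorConstLp_coeFn (p := 1) (hs := hE) (hμs := measure_ne_top μ E) (c := (1 : ℝ))]
    with x hx h1 h2
  rw [h1, Pi.sub_apply, h2, Real.norm_eq_abs]
  by_cases hxE : x ∈ E
  · simp only [hxE, Set.indicator_of_mem]
    rw [abs_of_nonpos (by linarith)]; ring
  · simp only [hxE, not_false_eq_true, Set.indicator_of_notMem]
    rw [abs_of_nonneg (by linarith)]; ring

theorem aux_cross (a : ℕ → ℝ) (r : ℝ) (hinc : Tendsto (fun k => |a (k + 1) - a k|) atTop (𝓝 0))
    (h1 : ∃ᶠ k in atTop, a k < r) (h2 : ∃ᶠ k in atTop, r < a k) (ε : ℝ) (hε : 0 < ε) :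
    ∃ᶠ k in atTop, |a k - r| < ε := by
  rw [frequently_atTop]
  intro N
  obtain ⟨N', hN'⟩ := eventually_atTop.1 (hinc.eventually (gt_mem_nhds hε))
  obtain ⟨k, hk, hka⟩ := frequently_atTop.1 h1 (max N N')
  obtain ⟨m, hm, hma⟩ := frequently_atTop.1 h2 k
  have hNk : N ≤ k := le_trans (le_max_left _ _) hk
  have hNk' : N' ≤ k := le_trans (le_max_right _ _) hk
  by_contra! hcon
  have : ∀ n, k ≤ n → a n < r := by
    intro n hn
    induction n, hn using Nat.le_induction with
    | base => exact hka
    | succ n hn ih =>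
      have e1 := hN' n (by omega)
      have e2 := hcon n (by omega)
      rw [abs_of_neg (by linarith)] at e2
      have := (abs_lt.1 e1).2
      linarith
  linarith [this m hm]

/-- Let `(f_k)` be a sequence in the admissible class `F(V₀) ⊆ L¹(μ)` with
`‖f_{k+1} − f_k‖_{L¹} → 0`. Assume (i) every subsequence has a further subsequence
converging weakly-* to a bang-bang function `1_E` with `μ E = V₀ μ(Ω)`, and (ii) the
sequence has two distinct `L¹`-closure points. Then it has infinitely many `L¹`-closure
points. -/
theorem infinitely_many_closure_points_of_two
    {Ω : Type*} [MeasurableSpace Ω] (μ : Measure Ω) [IsFiniteMeasure μ]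
    (V₀ : ℝ) (hV₀ : V₀ ∈ Set.Ioo (0 : ℝ) 1)
    (f : ℕ → Lp ℝ 1 μ)
    (hmem : ∀ k, (∀ᵐ x ∂μ, 0 ≤ f k x ∧ f k x ≤ 1) ∧
      ∫ x, f k x ∂μ = V₀ * (μ Set.univ).toReal)
    (hincr : Tendsto (fun k => ‖f (k + 1) - f k‖) atTop (𝓝 0))
    (hbang : ∀ φ : ℕ → ℕ, StrictMono φ → ∃ ψ : ℕ → ℕ, StrictMono ψ ∧ ∃ E : Set Ω,
      MeasurableSet E ∧ μ E = ENNReal.ofReal V₀ * μ Set.univ ∧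
      ∀ g : Ω → ℝ, Measurable g → (∃ M, ∀ x, |g x| ≤ M) →
        Tendsto (fun j => ∫ x, f (φ (ψ j)) x * g x ∂μ) atTop (𝓝 (∫ x in E, g x ∂μ)))
    (F₁ F₂ : Lp ℝ 1 μ)
    (hF₁ : ∃ φ : ℕ → ℕ, StrictMono φ ∧ Tendsto (fun j => f (φ j)) atTop (𝓝 F₁))
    (hF₂ : ∃ φ : ℕ → ℕ, StrictMono φ ∧ Tendsto (fun j => f (φ j)) atTop (𝓝 F₂))
    (hne : F₁ ≠ F₂) :
    {F : Lp ℝ 1 μ |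
      ∃ φ : ℕ → ℕ, StrictMono φ ∧ Tendsto (fun j => f (φ j)) atTop (𝓝 F)}.Infinite := by
  classical
  have hcomp : ∀ φ : ℕ → ℕ, StrictMono φ → ∃ ψ : ℕ → ℕ, StrictMono ψ ∧ ∃ G : Lp ℝ 1 μ,
      Tendsto (fun j => f (φ (ψ j))) atTop (𝓝 G) := by
    intro φ hφ
    obtain ⟨ψ, hψ, E, hE, -, hconv⟩ := hbang φ hφ
    refine ⟨ψ, hψ, indicatorConstLp 1 hE (measure_ne_top μ E) (1 : ℝ), ?_⟩
    rw [tendsto_iff_norm_sub_tendsto_zero]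
    simp_rw [fun j => aux_norm μ (f (φ (ψ j))) (hmem _).1 E hE]
    have hg := hconv (fun x => 1 - 2 * E.indicator (fun _ => (1 : ℝ)) x)
      (by
        have : Measurable (E.indicator (fun _ => (1 : ℝ))) := measurable_const.indicator hE
        fun_prop)
      ⟨1, fun x => by by_cases hx : x ∈ E <;> simp [hx]; norm_num⟩
    have h0 : (∫ x in E, (1 - 2 * E.indicator (fun _ => (1 : ℝ)) x) ∂μ)
        + ∫ x, E.indicator (fun _ => (1 : ℝ)) x ∂μ = 0 := by
      rw [integral_indicator hE, setIntegral_congr_fun (g := fun _ => (-1 : ℝ)) hE]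
      · simp
      · intro x hx
        simp [hx]; norm_num
    rw [← h0]
    exact hg.add tendsto_const_nhds
  obtain ⟨φ₁, hφ₁, hl₁⟩ := hF₁
  obtain ⟨φ₂, hφ₂, hl₂⟩ := hF₂
  have hd : 0 < ‖F₂ - F₁‖ := norm_pos_iff.2 (sub_ne_zero.2 hne.symm)
  apply Set.Infinite.of_image (fun F => ‖F - F₁‖)
  refine (Set.Ioo_infinite hd).mono ?_
  rintro r ⟨hr0, hr1⟩
  have hinc : Tendsto (fun k => |‖f (k + 1) - F₁‖ - ‖f k - F₁‖|) atTop (𝓝 0) := by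
    refine squeeze_zero (fun _ => abs_nonneg _) (fun k => ?_) hincr
    refine (abs_norm_sub_norm_le _ _).trans_eq ?_
    rw [sub_sub_sub_cancel_right]
  have h1 : ∃ᶠ k in atTop, ‖f k - F₁‖ < r := by
    have := (hl₁.sub_const F₁).norm
    rw [sub_self, norm_zero] at this
    exact hφ₁.tendsto_atTop.frequently (this.eventually (gt_mem_nhds hr0)).frequently
  have h2 : ∃ᶠ k in atTop, r < ‖f k - F₁‖ := by
    have := (hl₂.sub_const F₁).norm
    exact hφ₂.tendsto_atTop.frequently (this.eventually (lt_mem_nhds hr1)).frequently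
  obtain ⟨φ, hφ, hφr⟩ := extraction_forall_of_frequently
    (fun n : ℕ => aux_cross (fun k => ‖f k - F₁‖) r hinc h1 h2 (1 / ((n : ℝ) + 1))
      Nat.one_div_pos_of_nat)
  obtain ⟨ψ, hψ, G, hG⟩ := hcomp φ hφ
  refine ⟨G, ⟨φ ∘ ψ, hφ.comp hψ, hG⟩, ?_⟩
  have hlim : Tendsto (fun n => ‖f (φ n) - F₁‖) atTop (𝓝 r) := by
    rw [tendsto_iff_norm_sub_tendsto_zero]
    exact squeeze_zero (fun _ => norm_nonneg _) (fun n => (hφr n).le)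
      tendsto_one_div_add_atTop_nhds_zero_nat
  exact tendsto_nhds_unique (hG.sub_const F₁).norm (hlim.comp hψ.tendsto_atTop)
end

section
/- Let a ∈ (0,1). Then the infimum, over all continuously differentiable functions u : [−1,1] → ℝ with u(−1) = u(1) = 0 and u(a)² + u(−a)² > 0, of the quotient ( ∫_{−1}^{1} u′(t)² dt ) / ( u(a)² + u(−a)² ), equals 1/(1−a). Equivalently, writing a = 1 − ε/2 with ε ∈ (0,2), this infimum equals 2/ε. -/
lemma stek_cs (g : ℝ → ℝ) (p q : ℝ) (hpq : p < q) (hg : ContinuousOn g (Set.Icc p q)) :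
    (∫ t in p..q, g t) ^ 2 ≤ (q - p) * ∫ t in p..q, g t ^ 2 := by
  have hg' : ContinuousOn g (Set.uIcc p q) := by rwa [Set.uIcc_of_le hpq.le]
  set c := (∫ t in p..q, g t) / (q - p) with hc
  have h0 : 0 ≤ ∫ t in p..q, (g t - c) ^ 2 :=
    intervalIntegral.integral_nonneg hpq.le (fun t _ => sq_nonneg _)
  have e : ∫ t in p..q, (g t - c) ^ 2
      = (∫ t in p..q, g t ^ 2) - 2 * c * (∫ t in p..q, g t) + (q - p) * c ^ 2 := by
    have : ∀ t, (g t - c) ^ 2 = g t ^ 2 - 2 * c * g t + c ^ 2 := fun t => by ring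
    simp only [this]
    have i1 : IntervalIntegrable (fun t => g t ^ 2) MeasureTheory.volume p q :=
      (hg'.pow 2).intervalIntegrable
    have i2 : IntervalIntegrable (fun t => 2 * c * g t) MeasureTheory.volume p q :=
      (hg'.intervalIntegrable).const_mul _
    rw [intervalIntegral.integral_add (i1.sub i2) (by simp), intervalIntegral.integral_sub i1 i2]
    simp
  have hI : ∫ t in p..q, g t = c * (q - p) := by
    rw [hc]; field_simp [sub_ne_zero.2 hpq.ne']
  rw [e, hI] at h0
  rw [hI]
  nlinarith [mul_nonneg (sub_pos.2 hpq).le h0]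

lemma stek_lower (a : ℝ) (ha : a ∈ Set.Ioo (0 : ℝ) 1) (u : ℝ → ℝ)
    (hu : ContDiffOn ℝ 1 u (Set.Icc (-1) 1)) (h1 : u (-1) = 0) (h2 : u 1 = 0) :
    u a ^ 2 + u (-a) ^ 2 ≤
      (1 - a) * ∫ t in (-1 : ℝ)..1, derivWithin u (Set.Icc (-1) 1) t ^ 2 := by
  obtain ⟨ha0, ha1⟩ := ha
  set g := derivWithin u (Set.Icc (-1) 1) with hgdef
  have hg : ContinuousOn g (Set.Icc (-1) 1) :=
    hu.continuousOn_derivWithin (uniqueDiffOn_Icc (by norm_num)) le_rfl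
  have ftc : ∀ p q : ℝ, -1 ≤ p → p < q → q ≤ 1 → ∫ t in p..q, g t = u q - u p := by
    intro p q hp hpq hq
    have hs : Set.Icc p q ⊆ Set.Icc (-1) 1 := Set.Icc_subset_Icc hp hq
    apply intervalIntegral.integral_eq_sub_of_hasDerivAt_of_le hpq.le (hu.continuousOn.mono hs)
    · intro x hx
      have hx' : x ∈ Set.Icc (-1 : ℝ) 1 := hs ⟨hx.1.le, hx.2.le⟩
      have := (hu.differentiableOn (by norm_num) x hx').hasDerivWithinAt
      exact this.hasDerivAt (Icc_mem_nhds (by linarith [hx.1]) (by linarith [hx.2]))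
    · apply ContinuousOn.intervalIntegrable
      rw [Set.uIcc_of_le hpq.le]; exact hg.mono hs
  have ii : ∀ p q : ℝ, -1 ≤ p → p ≤ q → q ≤ 1 →
      IntervalIntegrable (fun t => g t ^ 2) MeasureTheory.volume p q := by
    intro p q hp hpq hq
    apply ContinuousOn.intervalIntegrable
    rw [Set.uIcc_of_le hpq]; exact (hg.mono (Set.Icc_subset_Icc hp hq)).pow 2
  have A := stek_cs g (-1) (-a) (by linarith) (hg.mono (Set.Icc_subset_Icc le_rfl (by linarith)))
  have B := stek_cs g a 1 ha1 (hg.mono (Set.Icc_subset_Icc (by linarith) le_rfl))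
  rw [ftc _ _ le_rfl (by linarith) (by linarith)] at A
  rw [ftc _ _ (by linarith) ha1 le_rfl] at B
  have M : 0 ≤ ∫ t in (-a)..a, g t ^ 2 :=
    intervalIntegral.integral_nonneg (by linarith) (fun t _ => sq_nonneg _)
  have S1 := intervalIntegral.integral_add_adjacent_intervals
    (ii (-1) (-a) le_rfl (by linarith) (by linarith)) (ii (-a) a (by linarith) (by linarith) ha1.le)
  have S2 := intervalIntegral.integral_add_adjacent_intervals
    (ii (-1) a le_rfl (by linarith) ha1.le) (ii a 1 (by linarith) ha1.le le_rfl)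
  rw [← S2, ← S1]
  rw [h1] at A
  rw [h2] at B
  nlinarith [mul_nonneg (sub_pos.2 ha1).le M]

lemma stek_upper (a d : ℝ) (ha : a ∈ Set.Ioo (0 : ℝ) 1) (hd : 0 < d) (hd' : d < 1 - a) :
    ∃ u : ℝ → ℝ, ContDiffOn ℝ 1 u (Set.Icc (-1) 1) ∧ u (-1) = 0 ∧ u 1 = 0 ∧
      u a = u (-a) ∧ 1 - a - d ≤ u (-a) ∧
      (∫ t in (-1 : ℝ)..1, derivWithin u (Set.Icc (-1) 1) t ^ 2) ≤ 2 * (1 - a) := by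
  obtain ⟨ha0, ha1⟩ := ha
  let k : ℝ → ℝ := fun s => max 0 (min 1 ((s - a) / d))
  let h : ℝ → ℝ := fun t => k (-t) - k t
  have hk : Continuous k := by fun_prop
  have hh : Continuous h := by fun_prop
  have k0 : ∀ s, 0 ≤ k s := fun s => le_max_left _ _
  have k1 : ∀ s, k s ≤ 1 := fun s => max_le zero_le_one (min_le_left _ _)
  have kz : ∀ s, s ≤ a → k s = 0 := fun s hs =>
    max_eq_left ((min_le_right _ _).trans (div_nonpos_of_nonpos_of_nonneg (by linarith) hd.le))
  have ko : ∀ s, a + d ≤ s → k s = 1 := fun s hs => by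
    have : 1 ≤ (s - a) / d := by rw [le_div_iff₀ hd]; linarith
    simp [k, min_eq_left this]
  have hodd : ∀ t, h (-t) = - h t := fun t => by simp [h]
  have ii : ∀ p q, IntervalIntegrable h MeasureTheory.volume p q := fun p q =>
    hh.intervalIntegrable p q
  have ii2 : ∀ p q, IntervalIntegrable (fun t => h t ^ 2) MeasureTheory.volume p q := fun p q =>
    (hh.pow 2).intervalIntegrable p q
  have oddint : ∀ b, ∫ t in (-b)..b, h t = 0 := by
    intro b
    have := intervalIntegral.integral_comp_neg (a := -b) (b := b) h
    simp only [hodd, neg_neg, intervalIntegral.integral_neg] at this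
    linarith
  have hder : ∀ t, HasDerivAt (fun x => ∫ s in (-1 : ℝ)..x, h s) (h t) t := fun t =>
    intervalIntegral.integral_hasDerivAt_right (ii _ _)
      (hh.stronglyMeasurableAtFilter _ _) hh.continuousAt
  have hsq : ∀ t, h t ^ 2 ≤ 1 := fun t => by
    have := k0 t; have := k0 (-t); have := k1 t; have := k1 (-t)
    simp only [h]; nlinarith
  refine ⟨fun x => ∫ s in (-1 : ℝ)..x, h s, ?_, by simp, oddint 1, ?_, ?_, ?_⟩
  · apply ContDiff.contDiffOn
    rw [contDiff_one_iff_deriv]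
    refine ⟨fun t => (hder t).differentiableAt, ?_⟩
    rw [show deriv (fun x => ∫ s in (-1 : ℝ)..x, h s) = h from funext fun t => (hder t).deriv]
    exact hh
  · have := intervalIntegral.integral_add_adjacent_intervals (ii (-1) (-a)) (ii (-a) a)
    rw [oddint, add_zero] at this
    exact this.symm
  · show _ ≤ ∫ s in (-1 : ℝ)..(-a), h s
    rw [← intervalIntegral.integral_add_adjacent_intervals (ii (-1) (-a-d)) (ii (-a-d) (-a))]
    have A : ∫ s in (-1 : ℝ)..(-a-d), h s = 1 - a - d := by
      rw [intervalIntegral.integral_congr (g := fun _ => (1:ℝ))]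
      · simp; ring
      · intro t ht
        rw [Set.uIcc_of_le (by linarith)] at ht
        simp only [h]
        rw [ko (-t) (by linarith [ht.2]), kz t (by linarith [ht.2])]; simp
    have B : 0 ≤ ∫ s in (-a-d)..(-a), h s := by
      apply intervalIntegral.integral_nonneg (by linarith)
      intro t ht
      simp only [h]
      rw [kz t (by linarith [ht.2])]; simpa using k0 (-t)
    linarith
  · have e : ∫ t in (-1 : ℝ)..1, derivWithin (fun x => ∫ s in (-1 : ℝ)..x, h s)
        (Set.Icc (-1) 1) t ^ 2 = ∫ t in (-1 : ℝ)..1, h t ^ 2 := by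
      apply intervalIntegral.integral_congr
      intro t ht
      rw [Set.uIcc_of_le (by norm_num)] at ht
      simp only
      rw [(hder t).hasDerivWithinAt.derivWithin (uniqueDiffOn_Icc (by norm_num) t ht)]
    rw [e, ← intervalIntegral.integral_add_adjacent_intervals (ii2 (-1) a) (ii2 a 1),
      ← intervalIntegral.integral_add_adjacent_intervals (ii2 (-1) (-a)) (ii2 (-a) a)]
    have bd : ∀ p q, p ≤ q → ∫ t in p..q, h t ^ 2 ≤ q - p := by
      intro p q hpq
      have := intervalIntegral.integral_mono_on hpq (ii2 p q)
        (intervalIntegrable_const (c := (1:ℝ))) (fun t _ => hsq t)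
      simpa using this
    have Z : ∫ t in (-a)..a, h t ^ 2 = 0 := by
      rw [intervalIntegral.integral_congr (g := fun _ => (0:ℝ))]
      · simp
      · intro t ht
        rw [Set.uIcc_of_le (by linarith)] at ht
        simp only [h]
        rw [kz (-t) (by linarith [ht.1]), kz t ht.2]; simp
    have := bd (-1) (-a) (by linarith)
    have := bd a 1 ha1.le
    linarith

lemma stek_main (a : ℝ) (ha : a ∈ Set.Ioo (0 : ℝ) 1) :
    sInf {r : ℝ | ∃ u : ℝ → ℝ, ContDiffOn ℝ 1 u (Set.Icc (-1) 1) ∧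
        u (-1) = 0 ∧ u 1 = 0 ∧ 0 < u a ^ 2 + u (-a) ^ 2 ∧
        r = (∫ t in (-1 : ℝ)..1, derivWithin u (Set.Icc (-1) 1) t ^ 2) /
          (u a ^ 2 + u (-a) ^ 2)} = 1 / (1 - a) := by
  have hL : 0 < 1 - a := sub_pos.2 ha.2
  have key : ∀ d, 0 < d → d < 1 - a → ∃ r ∈ {r : ℝ | ∃ u : ℝ → ℝ,
        ContDiffOn ℝ 1 u (Set.Icc (-1) 1) ∧
        u (-1) = 0 ∧ u 1 = 0 ∧ 0 < u a ^ 2 + u (-a) ^ 2 ∧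
        r = (∫ t in (-1 : ℝ)..1, derivWithin u (Set.Icc (-1) 1) t ^ 2) /
          (u a ^ 2 + u (-a) ^ 2)}, r ≤ (1 - a) / (1 - a - d) ^ 2 := by
    intro d hd hd'
    obtain ⟨u, hu, h1, h2, h3, h4, h5⟩ := stek_upper a d ha hd hd'
    have hp : 0 < 1 - a - d := by linarith
    have hq : (1 - a - d) ^ 2 ≤ u (-a) ^ 2 := by gcongr
    have hq0 : 0 < (1 - a - d) ^ 2 := by positivity
    refine ⟨_, ⟨u, hu, h1, h2, by rw [h3]; linarith, rfl⟩, ?_⟩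
    rw [h3, div_le_div_iff₀ (by linarith) hq0]
    calc _ ≤ 2 * (1 - a) * (1 - a - d) ^ 2 := by gcongr
      _ ≤ 2 * (1 - a) * u (-a) ^ 2 := by gcongr
      _ = _ := by ring
  apply csInf_eq_of_forall_ge_of_forall_gt_exists_lt
  · obtain ⟨r, hr, -⟩ := key ((1 - a) / 2) (by linarith) (by linarith)
    exact ⟨r, hr⟩
  · rintro r ⟨u, hu, h1, h2, h3, rfl⟩
    rw [div_le_div_iff₀ hL h3]
    linarith [stek_lower a ha u hu h1 h2]
  · intro w hw
    have hc : ContinuousAt (fun d : ℝ => (1 - a) / (1 - a - d) ^ 2) 0 := by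
      apply ContinuousAt.div (by fun_prop) (by fun_prop)
      simpa using hL.ne'
    have h0 : (1 - a) / (1 - a - 0) ^ 2 < w := by
      have e : (1 - a) / (1 - a - 0) ^ 2 = 1 / (1 - a) := by
        rw [sub_zero, div_eq_div_iff (by positivity) hL.ne']
        ring
      rw [e]
      exact hw
    have ev := (hc.eventually_lt_const h0).filter_mono (nhdsWithin_le_nhds (s := Set.Ioi 0))
    obtain ⟨d, hd, hd1, hd2⟩ := (ev.and (Ioo_mem_nhdsGT hL)).exists
    obtain ⟨r, hr, hr'⟩ := key d hd1 hd2
    exact ⟨r, hr, hr'.trans_lt hd⟩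



/-- For `a ∈ (0,1)`, the infimum over continuously differentiable
functions `u : [−1,1] → ℝ` with `u(−1) = u(1) = 0` and `u(a)² + u(−a)² > 0` of
`(∫_{−1}^1 u′(t)² dt) / (u(a)² + u(−a)²)` equals `1/(1−a)`; equivalently, writing
`a = 1 − ε/2` with `ε ∈ (0,2)`, it equals `2/ε`. -/
theorem one_dim_steklov_infimum (a : ℝ) (ha : a ∈ Set.Ioo (0 : ℝ) 1) :
    sInf {r : ℝ | ∃ u : ℝ → ℝ, ContDiffOn ℝ 1 u (Set.Icc (-1) 1) ∧
        u (-1) = 0 ∧ u 1 = 0 ∧ 0 < u a ^ 2 + u (-a) ^ 2 ∧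
        r = (∫ t in (-1 : ℝ)..1, derivWithin u (Set.Icc (-1) 1) t ^ 2) /
          (u a ^ 2 + u (-a) ^ 2)} = 1 / (1 - a) ∧
    ∀ ε ∈ Set.Ioo (0 : ℝ) 2, a = 1 - ε / 2 →
      sInf {r : ℝ | ∃ u : ℝ → ℝ, ContDiffOn ℝ 1 u (Set.Icc (-1) 1) ∧
        u (-1) = 0 ∧ u 1 = 0 ∧ 0 < u a ^ 2 + u (-a) ^ 2 ∧
        r = (∫ t in (-1 : ℝ)..1, derivWithin u (Set.Icc (-1) 1) t ^ 2) /
          (u a ^ 2 + u (-a) ^ 2)} = 2 / ε := by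
  refine ⟨stek_main a ha, fun ε hε h => ?_⟩
  rw [stek_main a ha, h]
  have := hε.1.ne'
  rw [show 1 - (1 - ε / 2) = ε / 2 by ring, one_div_div]
end
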